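/- arXiv:math/0311451 — 3 statements merged into one kernel-verified Lean document; each statement's English description precedes it below -/
import Mathlib

section
/- Let 𝔤 be a finite-dimensional real Lie algebra and 𝔱 ⊆ 𝔤 an abelian Lie subalgebra such that 𝔤 = 𝔱 ⊕ [𝔤,𝔱] as an internal direct sum of subspaces, and let B : 𝔤 → Dual ℝ 𝔤 be a symmetric linear map. If ξ ∈ 𝔱 satisfies ker(ad ξ) = 𝔱 and ⟨B ξ, [ξ,ζ]⟩ = 0 for every ζ ∈ 𝔤, then B ξ lies in the annihilator [𝔤,𝔱]° of [𝔤,𝔱] in Dual ℝ 𝔤. -/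
/-- Let `𝔤` be a finite-dimensional real Lie algebra, `𝔱 ⊆ 𝔤` an abelian
Lie subalgebra with `𝔤 = 𝔱 ⊕ [𝔤,𝔱]` as an internal direct sum of subspaces, and
`B : 𝔤 → 𝔤*` a symmetric linear map.  If `ξ ∈ 𝔱` satisfies `ker (ad ξ) = 𝔱` and
`⟨B ξ, [ξ,ζ]⟩ = 0` for every `ζ ∈ 𝔤`, then `B ξ` lies in the annihilator `[𝔤,𝔱]°`. -/
theorem symm_map_regular_elt_mem_annihilator
    (L : Type*) [LieRing L] [LieAlgebra ℝ L] [FiniteDimensional ℝ L]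
    (t : LieSubalgebra ℝ L) (habelian : IsLieAbelian t)
    (gt : Submodule ℝ L)
    (hgt : gt = Submodule.span ℝ {x : L | ∃ y : L, ∃ z ∈ t, x = ⁅y, z⁆})
    (hcompl : IsCompl (t : Submodule ℝ L) gt)
    (B : L →ₗ[ℝ] Module.Dual ℝ L) (hB : ∀ x y : L, B x y = B y x)
    (ξ : L) (hξ : ξ ∈ t)
    (hker : LinearMap.ker (LieAlgebra.ad ℝ L ξ) = (t : Submodule ℝ L))
    (hB0 : ∀ ζ : L, B ξ ⁅ξ, ζ⁆ = 0) :
    B ξ ∈ gt.dualAnnihilator := by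
  have hle : LinearMap.range (LieAlgebra.ad ℝ L ξ) ≤ gt := by
    rintro _ ⟨y, rfl⟩
    rw [hgt]
    refine Submodule.subset_span ⟨-y, ξ, hξ, ?_⟩
    rw [LieAlgebra.ad_apply, neg_lie, lie_skew]
  have h1 := LinearMap.finrank_range_add_finrank_ker (LieAlgebra.ad ℝ L ξ)
  have h2 := Submodule.finrank_add_eq_of_isCompl hcompl
  rw [hker] at h1
  have heq : LinearMap.range (LieAlgebra.ad ℝ L ξ) = gt :=
    Submodule.eq_of_le_of_finrank_eq hle (by omega)
  rw [Submodule.mem_dualAnnihilator]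
  intro w hw
  rw [← heq] at hw
  obtain ⟨y, rfl⟩ := hw
  exact hB0 y
end

section
/- Let 𝔤 be a finite-dimensional real Lie algebra and 𝔱 ⊆ 𝔤 an abelian Lie subalgebra such that 𝔤 = 𝔱 ⊕ [𝔤,𝔱] as an internal direct sum of subspaces, and let B : 𝔤 → Dual ℝ 𝔤 be a symmetric linear map. Assume (1) the set {ξ ∈ 𝔱 : ker(ad ξ) = 𝔱} is dense in 𝔱, and (2) ⟨B ξ, [ξ,ζ]⟩ = 0 for every ξ ∈ 𝔱 and every ζ ∈ 𝔤. Then B(𝔱) ⊆ [𝔤,𝔱]°, i.e. the image of 𝔱 under B is contained in the annihilator of [𝔤,𝔱] in Dual ℝ 𝔤. -/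
/-- Let `𝔤` be a finite-dimensional real Lie algebra, `𝔱 ⊆ 𝔤` an abelian
Lie subalgebra with `𝔤 = 𝔱 ⊕ [𝔤,𝔱]` as an internal direct sum of subspaces, and
`B : 𝔤 → 𝔤*` a symmetric linear map.  Assume (1) the set of `ξ ∈ 𝔱` with
`ker (ad ξ) = 𝔱` is dense in `𝔱` (subspace topology from `𝔤`), and (2)
`⟨B ξ, [ξ,ζ]⟩ = 0` for every `ξ ∈ 𝔱` and every `ζ ∈ 𝔤`.  Then `B 𝔱 ⊆ [𝔤,𝔱]°`. -/
theorem symm_map_torus_subset_annihilator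
    (L : Type*) [LieRing L] [LieAlgebra ℝ L] [FiniteDimensional ℝ L]
    [TopologicalSpace L] [IsTopologicalAddGroup L] [ContinuousSMul ℝ L] [T2Space L]
    (t : LieSubalgebra ℝ L) (habelian : IsLieAbelian t)
    (gt : Submodule ℝ L)
    (hgt : gt = Submodule.span ℝ {x : L | ∃ y : L, ∃ z ∈ t, x = ⁅y, z⁆})
    (hcompl : IsCompl (t : Submodule ℝ L) gt)
    (B : L →ₗ[ℝ] Module.Dual ℝ L) (hB : ∀ x y : L, B x y = B y x)
    (hdense : (t : Set L) ⊆
      closure {ξ : L | ξ ∈ t ∧ LinearMap.ker (LieAlgebra.ad ℝ L ξ) = (t : Submodule ℝ L)})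
    (hB0 : ∀ ξ ∈ t, ∀ ζ : L, B ξ ⁅ξ, ζ⁆ = 0) :
    ∀ ξ ∈ t, B ξ ∈ gt.dualAnnihilator := by
  intro ξ hξ
  rw [Submodule.mem_dualAnnihilator]
  intro w hw
  have hcont : Continuous fun x : L => B x w :=
    (B.flip w).continuous_of_finiteDimensional
  have hclosed : IsClosed {x : L | B x w = 0} := isClosed_eq hcont continuous_const
  refine closure_minimal ?_ hclosed (hdense hξ)
  rintro η ⟨hη, hker⟩
  have hle : LinearMap.range (LieAlgebra.ad ℝ L η) ≤ gt := by
    rintro _ ⟨y, rfl⟩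
    rw [hgt]
    refine Submodule.subset_span ⟨-y, η, hη, ?_⟩
    simp [lie_skew]
  have h1 := LinearMap.finrank_range_add_finrank_ker (LieAlgebra.ad ℝ L η)
  have h2 := Submodule.finrank_add_eq_of_isCompl hcompl
  rw [hker] at h1
  have heq : LinearMap.range (LieAlgebra.ad ℝ L η) = gt :=
    Submodule.eq_of_le_of_finrank_eq hle (by omega)
  rw [← heq] at hw
  obtain ⟨y, rfl⟩ := hw
  exact hB0 η hη y
end

section
/- Let V be a finite-dimensional real vector space, V = K₀ ⊕ K₁ ⊕ K₂ an internal direct sum of subspaces, and B : V → Dual ℝ V a symmetric linear map such that ker B = K₀ and B x ∈ K₂° for every x ∈ K₀ ⊔ K₁. Then B maps K₁ onto M₁ and K₂ onto M₂, i.e. B(K₁) = (K₀ ⊔ K₂)° and B(K₂) = (K₀ ⊔ K₁)°; consequently the range of B is the internal direct sum M₁ ⊕ M₂. -/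
/-- Let `V = K₀ ⊕ K₁ ⊕ K₂` be an internal direct sum of subspaces of a
finite-dimensional real vector space and `B : V → V*` a symmetric linear map with
`ker B = K₀` and `B x ∈ K₂°` for every `x ∈ K₀ ⊔ K₁`.  Then `B(K₁) = M₁ = (K₀ ⊔ K₂)°`
and `B(K₂) = M₂ = (K₀ ⊔ K₁)°`; consequently the range of `B` is the internal direct sum
`M₁ ⊕ M₂`. -/
theorem symm_map_components_of_triple_decomposition
    (V : Type*) [AddCommGroup V] [Module ℝ V] [FiniteDimensional ℝ V]
    (K₀ K₁ K₂ : Submodule ℝ V)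
    (hinternal : DirectSum.IsInternal (fun i : Fin 3 => ![K₀, K₁, K₂] i))
    (B : V →ₗ[ℝ] Module.Dual ℝ V) (hB : ∀ x y : V, B x y = B y x)
    (hker : LinearMap.ker B = K₀)
    (hann : ∀ x ∈ K₀ ⊔ K₁, B x ∈ K₂.dualAnnihilator) :
    Submodule.map B K₁ = (K₀ ⊔ K₂).dualAnnihilator ∧
    Submodule.map B K₂ = (K₀ ⊔ K₁).dualAnnihilator ∧
    LinearMap.range B = (K₀ ⊔ K₂).dualAnnihilator ⊔ (K₀ ⊔ K₁).dualAnnihilator ∧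
    Disjoint ((K₀ ⊔ K₂).dualAnnihilator) ((K₀ ⊔ K₁).dualAnnihilator) := by
  have htop : K₀ ⊔ K₁ ⊔ K₂ = ⊤ := by
    have h := hinternal.submodule_iSup_eq_top
    rw [eq_top_iff, ← h]
    refine iSup_le fun i => ?_
    fin_cases i
    · exact le_sup_left.trans le_sup_left
    · exact le_sup_right.trans le_sup_left
    · exact le_sup_right
  have hdec : ∀ v : V, ∃ a ∈ K₀, ∃ b ∈ K₁, ∃ c ∈ K₂, a + b + c = v := by
    intro v
    have hv : v ∈ K₀ ⊔ K₁ ⊔ K₂ := htop ▸ Submodule.mem_top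
    obtain ⟨w, hw, c, hc, rfl⟩ := Submodule.mem_sup.1 hv
    obtain ⟨a, ha, b, hb, rfl⟩ := Submodule.mem_sup.1 hw
    exact ⟨a, ha, b, hb, c, hc, rfl⟩
  have h0 : ∀ a ∈ K₀, B a = 0 := fun a ha => by
    rw [← hker] at ha
    exact ha
  have h0' : ∀ a ∈ K₀, ∀ v, B v a = 0 := fun a ha v => by
    rw [hB, h0 a ha]
    rfl
  have h12 : ∀ b ∈ K₁, ∀ c ∈ K₂, B b c = 0 := fun b hb c hc =>
    (Submodule.mem_dualAnnihilator _).1 (hann b (Submodule.mem_sup_right hb)) c hc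
  have h21 : ∀ c ∈ K₂, ∀ b ∈ K₁, B c b = 0 := fun c hc b hb => by
    rw [hB, h12 b hb c hc]
  have hext : ∀ φ : Module.Dual ℝ V, (∀ a ∈ K₀, φ a = 0) → (∀ a ∈ K₁, φ a = 0) →
      (∀ a ∈ K₂, φ a = 0) → φ = 0 := by
    intro φ p0 p1 p2
    ext v
    obtain ⟨a, ha, b, hb, c, hc, rfl⟩ := hdec v
    simp [p0 a ha, p1 b hb, p2 c hc]
  have hrange : LinearMap.range B = K₀.dualAnnihilator := by
    apply Submodule.eq_of_le_of_finrank_eq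
    · rintro _ ⟨v, rfl⟩
      rw [Submodule.mem_dualAnnihilator]
      exact fun a ha => h0' a ha v
    · have e1 := Subspace.finrank_add_finrank_dualAnnihilator_eq K₀
      have e2 := B.finrank_range_add_finrank_ker
      rw [hker] at e2
      omega
  have hs : ∀ (L L' : Submodule ℝ V) (φ : Module.Dual ℝ V), φ ∈ (L ⊔ L').dualAnnihilator ↔
      (∀ a ∈ L, φ a = 0) ∧ (∀ a ∈ L', φ a = 0) := by
    intro L L' φ
    rw [Submodule.dualAnnihilator_sup_eq, Submodule.mem_inf, Submodule.mem_dualAnnihilator,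
      Submodule.mem_dualAnnihilator]
  have m1 : Submodule.map B K₁ = (K₀ ⊔ K₂).dualAnnihilator := by
    ext φ
    rw [hs]
    constructor
    · rintro ⟨b, hb, rfl⟩
      exact ⟨fun a ha => h0' a ha b, h12 b hb⟩
    · rintro ⟨p0, p2⟩
      have hφ : φ ∈ LinearMap.range B := by
        rw [hrange, Submodule.mem_dualAnnihilator]
        exact p0
      obtain ⟨v, rfl⟩ := hφ
      obtain ⟨a, ha, b, hb, c, hc, rfl⟩ := hdec v
      have hc0 : B c = 0 := by
        refine hext _ (fun x hx => h0' x hx c) (h21 c hc) fun x hx => ?_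
        have := p2 x hx
        simpa [h0 a ha, h12 b hb x hx] using this
      exact ⟨b, hb, by simp [h0 a ha, hc0]⟩
  have m2 : Submodule.map B K₂ = (K₀ ⊔ K₁).dualAnnihilator := by
    ext φ
    rw [hs]
    constructor
    · rintro ⟨c, hc, rfl⟩
      exact ⟨fun a ha => h0' a ha c, h21 c hc⟩
    · rintro ⟨p0, p1⟩
      have hφ : φ ∈ LinearMap.range B := by
        rw [hrange, Submodule.mem_dualAnnihilator]
        exact p0
      obtain ⟨v, rfl⟩ := hφ
      obtain ⟨a, ha, b, hb, c, hc, rfl⟩ := hdec v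
      have hb0 : B b = 0 := by
        refine hext _ (fun x hx => h0' x hx b) (fun x hx => ?_) (h12 b hb)
        have := p1 x hx
        simpa [h0 a ha, h21 c hc x hx] using this
      exact ⟨c, hc, by simp [h0 a ha, hb0]⟩
  refine ⟨m1, m2, ?_, ?_⟩
  · rw [← m1, ← m2]
    apply le_antisymm
    · rintro _ ⟨v, rfl⟩
      obtain ⟨a, ha, b, hb, c, hc, rfl⟩ := hdec v
      rw [map_add, map_add, h0 a ha, zero_add]
      exact Submodule.add_mem_sup ⟨b, hb, rfl⟩ ⟨c, hc, rfl⟩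
    · exact sup_le LinearMap.map_le_range LinearMap.map_le_range
  · rw [Submodule.disjoint_def]
    intro φ p q
    rw [hs] at p q
    exact hext φ p.1 q.2 p.2
end
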